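/- Let S be a finite set of trajectories, let k ≥ 1, and let r > 0. Suppose there is a subset X ⊆ S with |X| ≤ k such that for every s ∈ S there is some x ∈ X with diam({s,x}) ≤ r. Then there exists a k-clustering 𝒞 of S with md(𝒞) ≤ (2 + √2)·r. -/

import Mathlib

noncomputable section

/-- Position at time `t` of the trajectory `(a, v)`, i.e. `a + v*t`. -/
def trajPos (s : ℝ × ℝ) (t : ℝ) : ℝ := s.1 + s.2 * t

/-- Diameter of a finite set of trajectories: the integral over `[0,1]` of the
width of the set of positions; `0` for the empty set. -/
noncomputable def kdiam (C : Finset (ℝ × ℝ)) : ℝ :=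
  if h : C.Nonempty then
    ∫ t in (0:ℝ)..1,
      (C.sup' h (fun s => trajPos s t) - C.inf' h (fun s => trajPos s t))
  else 0

/-- A `k`-clustering of `S`: pairwise disjoint (possibly empty) clusters
indexed by `Fin k` whose union is `S`. -/
def IsClustering (S : Finset (ℝ × ℝ)) (k : ℕ) (𝒞 : Fin k → Finset (ℝ × ℝ)) : Prop :=
  (∀ i j : Fin k, i ≠ j → Disjoint (𝒞 i) (𝒞 j)) ∧
  Finset.univ.biUnion 𝒞 = S

/-- Sum of the diameters of the clusters. -/
noncomputable def sd {k : ℕ} (𝒞 : Fin k → Finset (ℝ × ℝ)) : ℝ :=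
  ∑ i, kdiam (𝒞 i)

/-- Maximum diameter of a cluster. -/
noncomputable def md {k : ℕ} (𝒞 : Fin k → Finset (ℝ × ℝ)) : ℝ :=
  ⨆ i, kdiam (𝒞 i)

/-- An SD-optimal `k`-clustering: minimizes `sd` among all `k`-clusterings of `S`. -/
def SDOptimal (S : Finset (ℝ × ℝ)) (k : ℕ) (𝒞 : Fin k → Finset (ℝ × ℝ)) : Prop :=
  IsClustering S k 𝒞 ∧
  ∀ 𝒟 : Fin k → Finset (ℝ × ℝ), IsClustering S k 𝒟 → sd 𝒞 ≤ sd 𝒟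

/-- Optimal value of the maximum diameter over all `k`-clusterings of `S`. -/
noncomputable def optmd (S : Finset (ℝ × ℝ)) (k : ℕ) : ℝ :=
  sInf {x | ∃ 𝒞 : Fin k → Finset (ℝ × ℝ), IsClustering S k 𝒞 ∧ x = md 𝒞}

/-- The strip `{(x,t) : 0 ≤ t ≤ 1}`. -/
def strip : Set (ℝ × ℝ) := {p | 0 ≤ p.2 ∧ p.2 ≤ 1}

/-- The graph of a trajectory inside the strip. -/
def trajGraph (s : ℝ × ℝ) : Set (ℝ × ℝ) :=
  {p | 0 ≤ p.2 ∧ p.2 ≤ 1 ∧ p.1 = trajPos s p.2}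

/-- The strip minus the union of the graphs of the trajectories of `S`. -/
def freeRegion (S : Finset (ℝ × ℝ)) : Set (ℝ × ℝ) :=
  strip \ ⋃ s ∈ S, trajGraph s

/-- A hole of `S`: a connected component of the strip minus the graphs. -/
def IsHole (S : Finset (ℝ × ℝ)) (h : Set (ℝ × ℝ)) : Prop :=
  ∃ p ∈ freeRegion S, h = connectedComponentIn (freeRegion S) p

/-- `s` is to the left of the hole `h`. -/
def LeftOf (s : ℝ × ℝ) (h : Set (ℝ × ℝ)) : Prop :=
  ∃ p ∈ h, trajPos s p.2 < p.1

open Classical in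
/-- The trajectories of `S` to the left of `h`. -/
noncomputable def Sleft (S : Finset (ℝ × ℝ)) (h : Set (ℝ × ℝ)) : Finset (ℝ × ℝ) :=
  S.filter (fun s => LeftOf s h)

open Classical in
/-- The trajectories of `S` to the right of `h`. -/
noncomputable def Sright (S : Finset (ℝ × ℝ)) (h : Set (ℝ × ℝ)) : Finset (ℝ × ℝ) :=
  S.filter (fun s => ¬ LeftOf s h)

/-- The hole `h` separates the clusters `A` and `B`. -/
def Separates (S : Finset (ℝ × ℝ)) (h : Set (ℝ × ℝ))
    (A B : Finset (ℝ × ℝ)) : Prop :=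
  (A ⊆ Sleft S h ∧ B ⊆ Sright S h) ∨ (B ⊆ Sleft S h ∧ A ⊆ Sright S h)

/-- The span of a cluster: the region of the strip between its left and right sides. -/
noncomputable def cspan (C : Finset (ℝ × ℝ)) : Set (ℝ × ℝ) :=
  if h : C.Nonempty then
    {p | 0 ≤ p.2 ∧ p.2 ≤ 1 ∧
      C.inf' h (fun s => trajPos s p.2) ≤ p.1 ∧
      p.1 ≤ C.sup' h (fun s => trajPos s p.2)}
  else ∅

/-- A hole is covered by a clustering if it is contained in the span of some cluster. -/
def Covered {k : ℕ} (𝒞 : Fin k → Finset (ℝ × ℝ)) (h : Set (ℝ × ℝ)) : Prop :=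
  ∃ i, h ⊆ cspan (𝒞 i)

/-- A well-separated clustering: every two distinct nonempty clusters are
separated by some uncovered hole. -/
def WellSeparated (S : Finset (ℝ × ℝ)) (k : ℕ)
    (𝒞 : Fin k → Finset (ℝ × ℝ)) : Prop :=
  IsClustering S k 𝒞 ∧
  ∀ i j : Fin k, i ≠ j → (𝒞 i).Nonempty → (𝒞 j).Nonempty →
    ∃ h, IsHole S h ∧ ¬ Covered 𝒞 h ∧ Separates S h (𝒞 i) (𝒞 j)

end

theorem continuous_trajPos (s : ℝ × ℝ) : Continuous (trajPos s) := by
  unfold trajPos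
  fun_prop

theorem kdiam_pair (s x : ℝ × ℝ) :
    kdiam {s, x} = ∫ t in (0:ℝ)..1, |(s.1 - x.1) + (s.2 - x.2) * t| := by
  unfold kdiam
  rw [dif_pos (by simp)]
  congr 1
  ext t
  rw [Finset.sup'_insert (Finset.singleton_nonempty x),
    Finset.inf'_insert (Finset.singleton_nonempty x)]
  simp only [Finset.sup'_singleton, Finset.inf'_singleton, max_sub_min_eq_abs']
  congr 1
  unfold trajPos
  ring

theorem integral_affine (a b u v : ℝ) :
    ∫ t in u..v, (a + b * t) = a * (v - u) + b * ((v ^ 2 - u ^ 2) / 2) := by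
  rw [intervalIntegral.integral_add (by simp)
    ((by fun_prop : Continuous fun t : ℝ => b * t).intervalIntegrable _ _),
    intervalIntegral.integral_const_mul, integral_id, intervalIntegral.integral_const,
    smul_eq_mul, mul_comm a]

theorem intervalIntegrable_abs_affine (a b u v : ℝ) :
    IntervalIntegrable (fun t : ℝ => |a + b * t|) MeasureTheory.volume u v :=
  (by fun_prop : Continuous fun t : ℝ => |a + b * t|).intervalIntegrable _ _

/-- Testing an affine function against the sign function that switches at `c`. -/
theorem abs_le_integral_abs_affine (a b : ℝ) {c : ℝ} (hc₀ : 0 ≤ c) (hc₁ : c ≤ 1) :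
    |a * (1 - 2 * c) + b * ((1 - 2 * c ^ 2) / 2)| ≤ ∫ t in (0:ℝ)..1, |a + b * t| := by
  rw [← intervalIntegral.integral_add_adjacent_intervals
    (intervalIntegrable_abs_affine a b 0 c) (intervalIntegrable_abs_affine a b c 1)]
  have h₀ := intervalIntegral.abs_integral_le_integral_abs (f := fun t : ℝ => a + b * t)
    (μ := MeasureTheory.volume) hc₀
  have h₁ := intervalIntegral.abs_integral_le_integral_abs (f := fun t : ℝ => a + b * t)
    (μ := MeasureTheory.volume) hc₁
  rw [integral_affine] at h₀ h₁
  rw [abs_le] at h₀ h₁ ⊢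
  constructor <;> linarith [h₀.1, h₀.2, h₁.1, h₁.2]

/-- An affine function of small `L¹` norm on `[0, 1]` is pointwise bounded. -/
theorem abs_affine_le {a b r : ℝ} (h : ∫ t in (0:ℝ)..1, |a + b * t| ≤ r)
    {t : ℝ} (ht₀ : 0 ≤ t) (ht₁ : t ≤ 1) :
    |a + b * t| ≤ r * (1 + 2 * √2 * |t - 1 / 2|) := by
  have hs : √2 ^ 2 = 2 := Real.sq_sqrt (by norm_num)
  have hs₁ : 1 ≤ √2 := by nlinarith [Real.sqrt_nonneg 2]
  have hs₂ : √2 ≤ 2 := by nlinarith [Real.sqrt_nonneg 2]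
  have htest : ∀ c y : ℝ, 0 ≤ c → c ≤ 1 →
      y = a * (1 - 2 * c) + b * ((1 - 2 * c ^ 2) / 2) → |y| ≤ r := by
    rintro c y hc₀ hc₁ rfl
    exact (abs_le_integral_abs_affine a b hc₀ hc₁).trans h
  have hmid : |a + b / 2| ≤ r := htest 0 _ le_rfl zero_le_one (by ring)
  have hleft : |(√2 - 1) * a| ≤ r := by
    rw [← abs_neg]
    exact htest (√2 / 2) _ (by linarith) (by linarith) (by linear_combination b / 4 * hs)
  have hright : |(√2 - 1) * (a + b)| ≤ r :=
    htest (1 - √2 / 2) _ (by linarith) (by linarith) (by linear_combination b / 4 * hs)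
  have key : ∀ y : ℝ, |(√2 - 1) * y| ≤ r → |y| ≤ (1 + √2) * r := by
    intro y hy
    rw [abs_mul, abs_of_nonneg (by linarith)] at hy
    calc |y| = (1 + √2) * ((√2 - 1) * |y|) := by linear_combination -|y| * hs
      _ ≤ (1 + √2) * r := by gcongr
  have hleft := abs_le.1 (key _ hleft)
  have hright := abs_le.1 (key _ hright)
  rw [abs_le] at hmid
  rcases le_total t (1 / 2) with h' | h'
  · rw [abs_of_nonpos (by linarith : t - 1 / 2 ≤ 0), abs_le]
    have hw : 0 ≤ 1 - 2 * t := by linarith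
    constructor <;> nlinarith [mul_le_mul_of_nonneg_left hleft.1 hw,
      mul_le_mul_of_nonneg_left hleft.2 hw, mul_le_mul_of_nonneg_left hmid.1 ht₀,
      mul_le_mul_of_nonneg_left hmid.2 ht₀]
  · rw [abs_of_nonneg (by linarith : 0 ≤ t - 1 / 2), abs_le]
    have hw : 0 ≤ 2 * t - 1 := by linarith
    have hw' : 0 ≤ 1 - t := by linarith
    constructor <;> nlinarith [mul_le_mul_of_nonneg_left hright.1 hw,
      mul_le_mul_of_nonneg_left hright.2 hw, mul_le_mul_of_nonneg_left hmid.1 hw',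
      mul_le_mul_of_nonneg_left hmid.2 hw']

theorem integral_abs_sub_half : ∫ t in (0:ℝ)..1, |t - 1 / 2| = 1 / 4 := by
  have hint : ∀ u v : ℝ,
      IntervalIntegrable (fun t : ℝ => |t - 1 / 2|) MeasureTheory.volume u v := fun u v =>
    (by fun_prop : Continuous fun t : ℝ => |t - 1 / 2|).intervalIntegrable _ _
  rw [← intervalIntegral.integral_add_adjacent_intervals (hint 0 (1 / 2)) (hint (1 / 2) 1),
    intervalIntegral.integral_congr (a := 0) (b := 1 / 2) (g := fun t => 1 / 2 + (-1) * t),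
    intervalIntegral.integral_congr (a := 1 / 2) (b := 1) (g := fun t => -(1 / 2) + 1 * t),
    integral_affine, integral_affine]
  · norm_num
  · intro t ht
    rw [Set.uIcc_of_le (by norm_num)] at ht
    simp only
    rw [abs_of_nonneg (by linarith [ht.1])]
    ring
  · intro t ht
    rw [Set.uIcc_of_le (by norm_num)] at ht
    simp only
    rw [abs_of_nonpos (by linarith [ht.2])]
    ring

/-- A set of trajectories within distance `r` of a common one has diameter at most
`(2 + √2) * r`. -/
theorem kdiam_le_of_forall_kdiam_pair_le {C : Finset (ℝ × ℝ)} {x : ℝ × ℝ} {r : ℝ}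
    (hr : 0 ≤ r) (h : ∀ s ∈ C, kdiam {s, x} ≤ r) : kdiam C ≤ (2 + √2) * r := by
  unfold kdiam
  split_ifs with hC
  · have hcont : Continuous fun t : ℝ => 2 * √2 * |t - 1 / 2| := by fun_prop
    calc ∫ t in (0:ℝ)..1,
          (C.sup' hC (fun s => trajPos s t) - C.inf' hC (fun s => trajPos s t))
        ≤ ∫ t in (0:ℝ)..1, 2 * r * (1 + 2 * √2 * |t - 1 / 2|) := by
          apply intervalIntegral.integral_mono_on zero_le_one
          · apply Continuous.intervalIntegrable
            exact (Continuous.finset_sup'_apply hC fun s _ => continuous_trajPos s).sub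
              (Continuous.finset_inf'_apply hC fun s _ => continuous_trajPos s)
          · apply Continuous.intervalIntegrable
            fun_prop
          · intro t ht
            have hb : ∀ s ∈ C, |trajPos s t - trajPos x t| ≤
                r * (1 + 2 * √2 * |t - 1 / 2|) := by
              intro s hs
              have hsx := h s hs
              rw [kdiam_pair] at hsx
              convert abs_affine_le hsx ht.1 ht.2 using 2
              unfold trajPos
              ring
            have hsup : C.sup' hC (fun s => trajPos s t) ≤
                trajPos x t + r * (1 + 2 * √2 * |t - 1 / 2|) :=
              Finset.sup'_le _ _ fun s hs => by linarith [(abs_le.1 (hb s hs)).2]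
            have hinf : trajPos x t - r * (1 + 2 * √2 * |t - 1 / 2|) ≤
                C.inf' hC (fun s => trajPos s t) :=
              Finset.le_inf' _ _ fun s hs => by linarith [(abs_le.1 (hb s hs)).1]
            linarith
      _ = (2 + √2) * r := by
          rw [intervalIntegral.integral_const_mul, intervalIntegral.integral_add (by simp)
            (hcont.intervalIntegrable _ _), intervalIntegral.integral_const_mul,
            integral_abs_sub_half, intervalIntegral.integral_const, smul_eq_mul]
          ring
  · positivity

/-- from at most `k` centers covering `S` within pairwise diameter `r`
one gets a `k`-clustering of maximum diameter at most `(2 + √2) r`. -/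
theorem stmt11 (S : Finset (ℝ × ℝ)) (k : ℕ) (hk : 1 ≤ k) (r : ℝ) (hr : 0 < r)
    (X : Finset (ℝ × ℝ)) (hX : X ⊆ S) (hXk : X.card ≤ k)
    (hcov : ∀ s ∈ S, ∃ x ∈ X, kdiam {s, x} ≤ r) :
    ∃ 𝒞 : Fin k → Finset (ℝ × ℝ), IsClustering S k 𝒞 ∧
      md 𝒞 ≤ (2 + Real.sqrt 2) * r := by
  classical
  have : Nonempty (Fin k) := ⟨⟨0, hk⟩⟩
  have hcov' : ∀ s, ∃ x, s ∈ S → x ∈ X ∧ kdiam {s, x} ≤ r := fun s => by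
    by_cases hs : s ∈ S
    · obtain ⟨x, hx⟩ := hcov s hs
      exact ⟨x, fun _ => hx⟩
    · exact ⟨0, fun h => absurd h hs⟩
  choose center hcenter using hcov'
  obtain ⟨f, hf⟩ : ∃ f : ℝ × ℝ → Fin k, Set.InjOn f X := by
    obtain ⟨e⟩ : Nonempty (X ↪ Fin k) :=
      Function.Embedding.nonempty_of_card_le (by simpa using hXk)
    refine ⟨fun x => if h : x ∈ X then e ⟨x, h⟩ else ⟨0, hk⟩, fun x hx y hy hxy => ?_⟩
    simpa [Finset.mem_coe.1 hx, Finset.mem_coe.1 hy] using hxy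
  refine ⟨fun i => S.filter fun s => f (center s) = i, ⟨fun i j hij => ?_, ?_⟩, ?_⟩
  · rw [Finset.disjoint_filter]
    rintro s - rfl
    exact hij
  · ext s
    simp
  · refine ciSup_le fun i => ?_
    beta_reduce
    rcases (S.filter fun s => f (center s) = i).eq_empty_or_nonempty with he | ⟨s₀, hs₀⟩
    · rw [he, kdiam, dif_neg (by simp)]
      positivity
    · rw [Finset.mem_filter] at hs₀
      refine kdiam_le_of_forall_kdiam_pair_le (x := center s₀) hr.le fun s hs => ?_
      rw [Finset.mem_filter] at hs
      rw [← hf (hcenter s hs.1).1 (hcenter s₀ hs₀.1).1 (hs.2.trans hs₀.2.symm)]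
      exact (hcenter s hs.1).2
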